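/- arXiv:1707.08329 — 2 statements merged into one kernel-verified Lean document; each statement's English description precedes it below -/
import Mathlib

section
/- Let η ∈ ℝ and ε ∈ {0,1}. Let f, g : ℝ²∖{(0,0)} → ℂ be continuous, both homogeneous of degree 2iη−1 and of parity ε. Then for every x ∈ SL(2,ℝ), ∫_{−π}^{π} f((cos θ, sin θ)·x)·conj(g((cos θ, sin θ)·x)) dθ = ∫_{−π}^{π} f(cos θ, sin θ)·conj(g(cos θ, sin θ)) dθ; that is, the principal series representation with purely imaginary parameter preserves the L² inner product on the circle. -/
open MeasureTheory

/-- `f` is homogeneous of degree `2ζ-1` on `ℝ² ∖ {0}`. -/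
def IsHomog (ζ : ℂ) (f : ℝ × ℝ → ℂ) : Prop :=
  ∀ δ : ℝ, 0 < δ → ∀ v : ℝ × ℝ, v ≠ 0 → f (δ • v) = ((δ : ℂ) ^ (2 * ζ - 1)) * f v

/-- `f` has parity `ε ∈ {0,1}` on `ℝ² ∖ {0}`. -/
def HasParity (ε : ℕ) (f : ℝ × ℝ → ℂ) : Prop :=
  ∀ v : ℝ × ℝ, v ≠ 0 → f (-v) = (-1 : ℂ) ^ ε * f v

/-- The right action of `SL(2,ℝ)` on row vectors `v ∈ ℝ²`: `v · x`. -/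
def rowAct (x : Matrix.SpecialLinearGroup (Fin 2) ℝ) (v : ℝ × ℝ) : ℝ × ℝ :=
  (v.1 * x.1 0 0 + v.2 * x.1 1 0, v.1 * x.1 0 1 + v.2 * x.1 1 1)

open Set in
/-- In polar coordinates, a function homogeneous of degree `-2` integrates over the shell
`1 < ρ < 2` of any positive homogeneous gauge `ρ` to `log 2` times its integral on the circle. -/
theorem integral_shell_eq_log_two_mul (F : ℝ × ℝ → ℂ) (ρ : ℝ × ℝ → ℝ)
    (hF : ContinuousOn F {v | v ≠ 0})
    (hFh : ∀ δ : ℝ, 0 < δ → ∀ v : ℝ × ℝ, v ≠ 0 → F (δ • v) = ((δ : ℂ)⁻¹) ^ 2 * F v)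
    (hρ : Continuous ρ) (hρh : ∀ δ : ℝ, 0 < δ → ∀ v : ℝ × ℝ, ρ (δ • v) = δ * ρ v)
    (hρ0 : ∀ v : ℝ × ℝ, v ≠ 0 → 0 < ρ v) :
    ∫ v, {v | 1 < ρ v ∧ ρ v < 2}.indicator F v =
      (Real.log 2 : ℂ) * ∫ θ in (-Real.pi)..Real.pi, F (Real.cos θ, Real.sin θ) := by
  have hu0 (θ : ℝ) : ((Real.cos θ, Real.sin θ) : ℝ × ℝ) ≠ 0 := by
    intro h
    have h1 := congrArg Prod.fst h
    have h2 := congrArg Prod.snd h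
    simp only [Prod.fst_zero, Prod.snd_zero] at h1 h2
    have := Real.sin_sq_add_cos_sq θ
    rw [h1, h2] at this
    norm_num at this
  have huc : Continuous fun θ : ℝ => ((Real.cos θ, Real.sin θ) : ℝ × ℝ) := by fun_prop
  have hFu : Continuous fun θ : ℝ => F (Real.cos θ, Real.sin θ) :=
    hF.comp_continuous huc hu0
  set σ : ℝ → ℝ := fun θ => ρ (Real.cos θ, Real.sin θ) with hσ
  have hσc : Continuous σ := hρ.comp huc
  have hσ0 (θ : ℝ) : 0 < σ θ := hρ0 _ (hu0 θ)
  set U : Set (ℝ × ℝ) := {p | 1 < p.1 * σ p.2 ∧ p.1 * σ p.2 < 2} with hU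
  set G : ℝ × ℝ → ℂ := fun p => (p.1 : ℂ)⁻¹ * F (Real.cos p.2, Real.sin p.2) with hG
  have hUm : MeasurableSet U := by
    have hc : Continuous fun p : ℝ × ℝ => p.1 * σ p.2 := by fun_prop
    exact ((isOpen_lt continuous_const hc).inter (isOpen_lt hc continuous_const)).measurableSet
  have hpolar : ∫ v, {v | 1 < ρ v ∧ ρ v < 2}.indicator F v =
      ∫ p in Ioi (0 : ℝ) ×ˢ Ioo (-Real.pi) Real.pi, U.indicator G p := by
    rw [← integral_comp_polarCoord_symm, polarCoord_target]
    refine setIntegral_congr_fun (measurableSet_Ioi.prod measurableSet_Ioo) fun p hp => ?_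
    have hp0 : 0 < p.1 := hp.1
    have hsymm : polarCoord.symm p = p.1 • ((Real.cos p.2, Real.sin p.2) : ℝ × ℝ) := by
      simp [polarCoord_symm_apply]
    have hmem : polarCoord.symm p ∈ {v | 1 < ρ v ∧ ρ v < 2} ↔ p ∈ U := by
      rw [hsymm, mem_ofPred_eq, hρh _ hp0, hU, mem_ofPred_eq]
    by_cases hpU : p ∈ U
    · simp only [indicator_of_mem hpU, indicator_of_mem (hmem.2 hpU)]
      rw [hsymm, hFh _ hp0 _ (hu0 _), Complex.real_smul, hG]
      have : (p.1 : ℂ) ≠ 0 := by exact_mod_cast hp0.ne'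
      field_simp
    · simp only [indicator_of_notMem hpU, indicator_of_notMem (mt hmem.1 hpU), smul_zero]
  have hint : IntegrableOn (U.indicator G) (Ioi (0 : ℝ) ×ˢ Ioo (-Real.pi) Real.pi)
      (volume.prod volume) := by
    have hne : (Icc (-Real.pi) Real.pi).Nonempty := ⟨0, by simp [Real.pi_pos.le]⟩
    obtain ⟨θ₁, -, hmin⟩ := isCompact_Icc.exists_isMinOn hne hσc.continuousOn
    obtain ⟨θ₂, -, hmax⟩ := isCompact_Icc.exists_isMaxOn hne hσc.continuousOn
    have hcompact : IsCompact (Icc (1 / σ θ₂) (2 / σ θ₁) ×ˢ Icc (-Real.pi) Real.pi) :=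
      isCompact_Icc.prod isCompact_Icc
    have hGc : ContinuousOn G (Icc (1 / σ θ₂) (2 / σ θ₁) ×ˢ Icc (-Real.pi) Real.pi) := by
      refine ContinuousOn.mul (ContinuousOn.inv₀ (by fun_prop) fun p hp => ?_)
        (hFu.comp continuous_snd).continuousOn
      have : 0 < p.1 := lt_of_lt_of_le (one_div_pos.2 (hσ0 _)) hp.1.1
      exact_mod_cast this.ne'
    have hcpt : IntegrableOn (U.indicator G)
        (Icc (1 / σ θ₂) (2 / σ θ₁) ×ˢ Icc (-Real.pi) Real.pi) (volume.prod volume) :=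
      IntegrableOn.indicator (hGc.integrableOn_compact hcompact) hUm
    refine hcpt.of_forall_sdiff_eq_zero
      (measurableSet_Ioi.prod measurableSet_Ioo) fun p hp => indicator_of_notMem (fun hpU => ?_) _
    obtain ⟨⟨hp0, hpθ⟩, hpn⟩ := hp
    have hp0 : 0 < p.1 := hp0
    have hθ : p.2 ∈ Icc (-Real.pi) Real.pi := Ioo_subset_Icc_self hpθ
    have h1 : σ θ₁ ≤ σ p.2 := hmin hθ
    have h2 : σ p.2 ≤ σ θ₂ := hmax hθ
    refine hpn ⟨⟨?_, ?_⟩, hθ⟩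
    · rw [div_le_iff₀ (hσ0 _)]
      exact hpU.1.le.trans (by gcongr)
    · rw [le_div_iff₀ (hσ0 _)]
      exact le_trans (by gcongr) hpU.2.le
  have hinner (θ : ℝ) : ∫ r in Ioi (0 : ℝ), U.indicator G (r, θ) =
      (Real.log 2 : ℂ) * F (Real.cos θ, Real.sin θ) := by
    have hs := hσ0 θ
    have hle : 1 / σ θ ≤ 2 / σ θ := by gcongr; norm_num
    have hind : ∀ r, U.indicator G (r, θ) = (Ioo (1 / σ θ) (2 / σ θ)).indicator
        (fun r : ℝ => (r : ℂ)⁻¹ * F (Real.cos θ, Real.sin θ)) r := by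
      intro r
      have : (r, θ) ∈ U ↔ r ∈ Ioo (1 / σ θ) (2 / σ θ) := by
        rw [mem_Ioo, div_lt_iff₀ hs, lt_div_iff₀ hs]
        rfl
      by_cases hr : r ∈ Ioo (1 / σ θ) (2 / σ θ)
      · rw [indicator_of_mem hr, indicator_of_mem (this.2 hr)]
      · rw [indicator_of_notMem hr, indicator_of_notMem (mt this.1 hr)]
    have hsub : Ioi (0 : ℝ) ∩ Ioo (1 / σ θ) (2 / σ θ) = Ioo (1 / σ θ) (2 / σ θ) :=
      inter_eq_right.2 fun r hr => (one_div_pos.2 hs).trans hr.1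
    simp only [hind]
    rw [setIntegral_indicator measurableSet_Ioo, hsub, integral_mul_const,
      ← integral_Ioc_eq_integral_Ioo, ← intervalIntegral.integral_of_le hle]
    congr 1
    have : ∀ r : ℝ, (r : ℂ)⁻¹ = ((r⁻¹ : ℝ) : ℂ) := fun r => (Complex.ofReal_inv r).symm
    simp only [this]
    rw [intervalIntegral.integral_ofReal, integral_inv_of_pos (by positivity) (by positivity)]
    congr 2
    field_simp
  rw [hpolar, Measure.volume_eq_prod, ← Measure.prod_restrict, integral_prod_symm]
  · simp only [hinner]
    rw [integral_const_mul, ← integral_Ioc_eq_integral_Ioo,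
      ← intervalIntegral.integral_of_le (by linarith [Real.pi_pos])]
  · rwa [Measure.prod_restrict]

theorem continuous_rowAct (x : Matrix.SpecialLinearGroup (Fin 2) ℝ) : Continuous (rowAct x) := by
  unfold rowAct
  fun_prop

theorem rowAct_smul (x : Matrix.SpecialLinearGroup (Fin 2) ℝ) (δ : ℝ) (v : ℝ × ℝ) :
    rowAct x (δ • v) = δ • rowAct x v := by
  ext <;> simp [rowAct] <;> ring

theorem rowAct_inv_rowAct (x : Matrix.SpecialLinearGroup (Fin 2) ℝ) (v : ℝ × ℝ) :
    rowAct x⁻¹ (rowAct x v) = v := by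
  have hdet := x.2
  rw [Matrix.det_fin_two] at hdet
  rw [Matrix.SpecialLinearGroup.SL2_inv_expl]
  ext <;> simp [rowAct]
  · linear_combination v.1 * hdet
  · linear_combination v.2 * hdet

theorem rowAct_rowAct_inv (x : Matrix.SpecialLinearGroup (Fin 2) ℝ) (v : ℝ × ℝ) :
    rowAct x (rowAct x⁻¹ v) = v := by
  simpa using rowAct_inv_rowAct x⁻¹ v

theorem rowAct_ne_zero (x : Matrix.SpecialLinearGroup (Fin 2) ℝ) {v : ℝ × ℝ} (hv : v ≠ 0) :
    rowAct x v ≠ 0 := by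
  intro h
  apply hv
  rw [← rowAct_inv_rowAct x v, h]
  simp [rowAct]

/-- The action of `x ∈ SL(2,ℝ)` on row vectors as a homeomorphism. -/
def rowActHomeomorph (x : Matrix.SpecialLinearGroup (Fin 2) ℝ) : ℝ × ℝ ≃ₜ ℝ × ℝ where
  toFun := rowAct x
  invFun := rowAct x⁻¹
  left_inv := rowAct_inv_rowAct x
  right_inv := rowAct_rowAct_inv x
  continuous_toFun := continuous_rowAct x
  continuous_invFun := continuous_rowAct x⁻¹

theorem measurePreserving_rowAct (x : Matrix.SpecialLinearGroup (Fin 2) ℝ) :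
    MeasurePreserving (rowAct x) := by
  refine ⟨(continuous_rowAct x).measurable, ?_⟩
  set b := Module.Basis.finTwoProd ℝ
  have hdet : LinearMap.det (Matrix.toLin b b x.1.transpose) = 1 := by
    rw [LinearMap.det_toLin, Matrix.det_transpose, x.2]
  have hcoe : rowAct x = Matrix.toLin b b x.1.transpose := by
    funext v
    rw [Matrix.eta_fin_two x.1.transpose, Matrix.toLin_finTwoProd_apply]
    ext <;> simp [rowAct] <;> ring
  rw [hcoe, Measure.map_linearMap_addHaar_eq_smul_addHaar _ (by rw [hdet]; norm_num), hdet]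
  simp

/-- The integral over the circle of a function homogeneous of degree `-2` is
`SL(2,ℝ)`-invariant. -/
theorem integral_circle_rowAct (F : ℝ × ℝ → ℂ) (hF : ContinuousOn F {v | v ≠ 0})
    (hFh : ∀ δ : ℝ, 0 < δ → ∀ v : ℝ × ℝ, v ≠ 0 → F (δ • v) = ((δ : ℂ)⁻¹) ^ 2 * F v)
    (x : Matrix.SpecialLinearGroup (Fin 2) ℝ) :
    ∫ θ in (-Real.pi)..Real.pi, F (rowAct x (Real.cos θ, Real.sin θ)) =
      ∫ θ in (-Real.pi)..Real.pi, F (Real.cos θ, Real.sin θ) := by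
  have hlog : (Real.log 2 : ℂ) ≠ 0 := by
    exact_mod_cast (Real.log_pos one_lt_two).ne'
  apply mul_left_cancel₀ hlog
  rw [← integral_shell_eq_log_two_mul (fun v => F (rowAct x v)) (fun v => ‖v‖)
      (hF.comp (continuous_rowAct x).continuousOn fun v hv => rowAct_ne_zero x hv)
      (fun δ hδ v hv => by rw [rowAct_smul, hFh δ hδ _ (rowAct_ne_zero x hv)])
      continuous_norm (fun δ hδ v => by rw [norm_smul, Real.norm_of_nonneg hδ.le])
      (fun v hv => norm_pos_iff.2 hv),
    ← integral_shell_eq_log_two_mul F (fun v => ‖rowAct x⁻¹ v‖) hF hFh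
      (continuous_rowAct x⁻¹).norm
      (fun δ hδ v => by rw [rowAct_smul, norm_smul, Real.norm_of_nonneg hδ.le])
      (fun v hv => norm_pos_iff.2 (rowAct_ne_zero x⁻¹ hv))]
  refine Eq.trans ?_
    ((measurePreserving_rowAct x).integral_comp (rowActHomeomorph x).measurableEmbedding _)
  refine integral_congr_ae (Filter.Eventually.of_forall fun v => ?_)
  simp only [Set.indicator, Set.mem_ofPred_eq, rowAct_inv_rowAct]

theorem IsHomog.mul_conj {η : ℝ} {f g : ℝ × ℝ → ℂ} (hf : IsHomog ((η : ℂ) * Complex.I) f)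
    (hg : IsHomog ((η : ℂ) * Complex.I) g) (δ : ℝ) (hδ : 0 < δ) (v : ℝ × ℝ) (hv : v ≠ 0) :
    f (δ • v) * (starRingEnd ℂ) (g (δ • v)) =
      ((δ : ℂ)⁻¹) ^ 2 * (f v * (starRingEnd ℂ) (g v)) := by
  have hnorm : ‖(δ : ℂ) ^ (2 * ((η : ℂ) * Complex.I) - 1)‖ = δ⁻¹ := by
    rw [Complex.norm_cpow_eq_rpow_re_of_pos hδ]
    simp [Real.rpow_neg_one]
  have hmul := Complex.mul_conj' ((δ : ℂ) ^ (2 * ((η : ℂ) * Complex.I) - 1))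
  rw [hnorm, Complex.ofReal_inv] at hmul
  rw [hf δ hδ v hv, hg δ hδ v hv, map_mul, ← hmul]
  ring

/-- with `f, g` continuous, homogeneous of degree `2iη-1` and of parity `ε`,
`∫_{-π}^{π} f((cos θ, sin θ)·x) conj(g((cos θ, sin θ)·x)) dθ` is independent of `x ∈ SL(2,ℝ)`:
the principal series with purely imaginary parameter preserves the `L²` inner product. -/
theorem stmt_5 (η : ℝ) (ε : ℕ) (hε : ε = 0 ∨ ε = 1) (f g : ℝ × ℝ → ℂ)
    (hfc : ContinuousOn f {v : ℝ × ℝ | v ≠ 0}) (hgc : ContinuousOn g {v : ℝ × ℝ | v ≠ 0})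
    (hf : IsHomog ((η : ℂ) * Complex.I) f) (hg : IsHomog ((η : ℂ) * Complex.I) g)
    (hfp : HasParity ε f) (hgp : HasParity ε g) :
    ∀ x : Matrix.SpecialLinearGroup (Fin 2) ℝ,
      (∫ θ in (-Real.pi)..Real.pi,
          f (rowAct x (Real.cos θ, Real.sin θ)) *
            (starRingEnd ℂ) (g (rowAct x (Real.cos θ, Real.sin θ))))
        = ∫ θ in (-Real.pi)..Real.pi,
            f (Real.cos θ, Real.sin θ) * (starRingEnd ℂ) (g (Real.cos θ, Real.sin θ)) := by
  intro x
  exact integral_circle_rowAct (fun v => f v * (starRingEnd ℂ) (g v))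
    (hfc.mul (Complex.continuous_conj.comp_continuousOn hgc)) (hf.mul_conj hg) x
end

section
/- Let ε ∈ {0,1}, let μ ∈ ℤ with μ ≡ ε (mod 2), and let ζ ∈ ℂ with −1/2 < Re ζ < 0. Then for every θ ∈ ℝ, (1/2)·∫_{−π}^{π} e^{iμφ}·sgn(sin(φ−θ))^ε·|sin(φ−θ)|^{−1−2ζ} dφ = b(ζ,μ)·e^{iμθ}, where b(ζ,μ) = σ(μ,ε)·2^{1+2ζ}·π·Γ(−2ζ)/(Γ(1/2−ζ+μ/2)·Γ(1/2−ζ−μ/2)) and σ(μ,ε) = (1−ε)·cos(μπ/2) + i·ε·sin(μπ/2). In other words, the circle functions θ ↦ e^{iμθ} are eigenfunctions of the intertwining integral operator with kernel sgn(sin(φ−θ))^ε·|sin(φ−θ)|^{−1−2ζ}. -/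
open MeasureTheory

lemma cpow_sub_one_mul_self {x : ℂ} (hx : x ≠ 0) (c : ℂ) : x ^ (c - 1) * x = x ^ c := by
  rw [Complex.cpow_sub _ _ hx, Complex.cpow_one, div_mul_cancel₀ _ hx]

lemma sin_cpow_eq_smul_beta_integrand (a : ℂ) {φ : ℝ} (hφ : φ ∈ Set.Ioo 0 Real.pi) :
    ((Real.sin φ : ℝ) : ℂ) ^ (a - 1) = (2 : ℂ) ^ (a - 1) * (|Real.sin φ / 2| •
      ((((1 - Real.cos φ) / 2 : ℝ) : ℂ) ^ (a / 2 - 1) *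
        (1 - (((1 - Real.cos φ) / 2 : ℝ) : ℂ)) ^ (a / 2 - 1))) := by
  have hs : 0 < Real.sin φ / 2 := half_pos (Real.sin_pos_of_mem_Ioo hφ)
  have hsc := Real.sin_sq_add_cos_sq φ
  have hc1 := Real.cos_le_one φ
  have hc2 := Real.neg_one_le_cos φ
  have h1 : (1 : ℂ) - (((1 - Real.cos φ) / 2 : ℝ) : ℂ) = ((1 - (1 - Real.cos φ) / 2 : ℝ) : ℂ) := by
    push_cast; ring
  rw [h1, ← Complex.mul_cpow_ofReal_nonneg (by linarith) (by linarith), ← Complex.ofReal_mul,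
    show (1 - Real.cos φ) / 2 * (1 - (1 - Real.cos φ) / 2) = Real.sin φ / 2 * (Real.sin φ / 2) by
      linear_combination -hsc / 4,
    abs_of_pos hs, Complex.ofReal_mul, Complex.mul_cpow_ofReal_nonneg hs.le hs.le]
  set y : ℝ := Real.sin φ / 2 with hy
  have hy0 : (y : ℂ) ≠ 0 := Complex.ofReal_ne_zero.mpr hs.ne'
  have h2 : ((Real.sin φ : ℝ) : ℂ) = ((2 : ℝ) : ℂ) * (y : ℂ) := by
    rw [hy]; push_cast; ring
  have h3 : (y : ℂ) ^ (a - 1) = y * ((y : ℂ) ^ (a / 2 - 1) * (y : ℂ) ^ (a / 2 - 1)) := by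
    rw [← Complex.cpow_add _ _ hy0, mul_comm,
      show a / 2 - 1 + (a / 2 - 1) = a - 1 - 1 by ring, cpow_sub_one_mul_self hy0]
  rw [h2, Complex.mul_cpow_ofReal_nonneg zero_le_two hs.le, h3, Complex.real_smul]
  norm_num

lemma hasDerivAt_one_sub_cos_div_two (φ : ℝ) :
    HasDerivAt (fun t => (1 - Real.cos t) / 2) (Real.sin φ / 2) φ := by
  simpa using ((Real.hasDerivAt_cos φ).const_sub 1).div_const 2

lemma injOn_one_sub_cos_div_two :
    Set.InjOn (fun t => (1 - Real.cos t) / 2) (Set.Ioo 0 Real.pi) := fun x hx y hy h =>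
  Real.injOn_cos (Set.Ioo_subset_Icc_self hx) (Set.Ioo_subset_Icc_self hy) (by
    simp only at h; linarith)

lemma image_one_sub_cos_div_two :
    (fun t => (1 - Real.cos t) / 2) '' Set.Ioo 0 Real.pi = Set.Ioo 0 1 := by
  ext x
  constructor
  · rintro ⟨t, ht, rfl⟩
    have h1 := Real.strictAntiOn_cos (Set.left_mem_Icc.mpr Real.pi_pos.le)
      (Set.Ioo_subset_Icc_self ht) ht.1
    have h2 := Real.strictAntiOn_cos (Set.Ioo_subset_Icc_self ht)
      (Set.right_mem_Icc.mpr Real.pi_pos.le) ht.2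
    rw [Real.cos_zero] at h1
    rw [Real.cos_pi] at h2
    constructor <;> simp only <;> linarith
  · intro hx
    refine ⟨Real.arccos (1 - 2 * x), ⟨Real.arccos_pos.mpr (by linarith [hx.1]), ?_⟩, ?_⟩
    · refine lt_of_le_of_ne (Real.arccos_le_pi _) fun h => ?_
      rw [Real.arccos_eq_pi] at h
      linarith [hx.2]
    · simp only
      rw [Real.cos_arccos (by linarith [hx.2]) (by linarith [hx.1])]
      ring

/-- `sin ^ (a - 1)` is integrable on `[0, π]` for `0 < re a`. -/
lemma intervalIntegrable_sin_cpow {a : ℂ} (ha : 0 < a.re) :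
    IntervalIntegrable (fun φ : ℝ => ((Real.sin φ : ℝ) : ℂ) ^ (a - 1)) volume 0 Real.pi := by
  have ha2 : 0 < (a / 2).re := by simpa using ha
  have hb := Complex.betaIntegral_convergent ha2 ha2
  rw [intervalIntegrable_iff_integrableOn_Ioo_of_le zero_le_one,
    ← image_one_sub_cos_div_two, integrableOn_image_iff_integrableOn_abs_deriv_smul
      measurableSet_Ioo (fun x _ => (hasDerivAt_one_sub_cos_div_two x).hasDerivWithinAt)
      injOn_one_sub_cos_div_two] at hb
  rw [intervalIntegrable_iff_integrableOn_Ioo_of_le Real.pi_pos.le]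
  exact IntegrableOn.congr_fun (hb.const_mul ((2 : ℂ) ^ (a - 1)))
    (fun φ hφ => (sin_cpow_eq_smul_beta_integrand a hφ).symm) measurableSet_Ioo

lemma integral_sin_cpow_eq_betaIntegral (a : ℂ) :
    ∫ φ in (0 : ℝ)..Real.pi, ((Real.sin φ : ℝ) : ℂ) ^ (a - 1) =
      (2 : ℂ) ^ (a - 1) * Complex.betaIntegral (a / 2) (a / 2) := by
  rw [Complex.betaIntegral, intervalIntegral.integral_of_le zero_le_one,
    integral_Ioc_eq_integral_Ioo, ← image_one_sub_cos_div_two,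
    integral_image_eq_integral_abs_deriv_smul
      measurableSet_Ioo (fun x _ => (hasDerivAt_one_sub_cos_div_two x).hasDerivWithinAt)
      injOn_one_sub_cos_div_two, intervalIntegral.integral_of_le Real.pi_pos.le,
    integral_Ioc_eq_integral_Ioo, ← integral_const_mul]
  exact setIntegral_congr_fun measurableSet_Ioo fun φ hφ => sin_cpow_eq_smul_beta_integrand a hφ

/-- The integral of `sin ^ (a - 1)` over `[0, π]`, for `0 < re a`. -/
lemma integral_sin_cpow {a : ℂ} (ha : 0 < a.re) :
    ∫ φ in (0 : ℝ)..Real.pi, ((Real.sin φ : ℝ) : ℂ) ^ (a - 1) =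
      (2 : ℂ) ^ (a - 1) * Complex.Gamma (a / 2) ^ 2 / Complex.Gamma a := by
  have ha2 : 0 < (a / 2).re := by simpa using ha
  rw [integral_sin_cpow_eq_betaIntegral, Complex.betaIntegral_eq_Gamma_mul_div _ _ ha2 ha2,
    add_halves]
  ring

lemma Gamma_half_sq_mul_Gamma_half_add_half_sq (a : ℂ) :
    Complex.Gamma (a / 2) ^ 2 * Complex.Gamma ((a + 1) / 2) ^ 2 =
      Complex.Gamma a ^ 2 * ((2 : ℂ) ^ (1 - a)) ^ 2 * Real.pi := by
  have h := Complex.Gamma_mul_Gamma_add_half (a / 2)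
  rw [show a / 2 + 1 / 2 = (a + 1) / 2 by ring, mul_div_cancel₀ a two_ne_zero] at h
  have hpi : ((√Real.pi : ℝ) : ℂ) ^ 2 = Real.pi := by
    rw [← Complex.ofReal_pow, Real.sq_sqrt Real.pi_pos.le]
  rw [← mul_pow, h, mul_pow, mul_pow, hpi]

/-- The Fourier integral of `sin ^ (s - 1)` on `[0, π]` at integer frequency. -/
noncomputable def sinFourier (s : ℂ) (n : ℤ) : ℂ :=
  ∫ φ in (0 : ℝ)..Real.pi, Complex.exp (n * φ * Complex.I) * ((Real.sin φ : ℝ) : ℂ) ^ (s - 1)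

/-- The closed form of `sinFourier`. -/
noncomputable def sinFourierValue (s : ℂ) (n : ℤ) : ℂ :=
  Complex.exp (n * Real.pi / 2 * Complex.I) * ((2 : ℂ) ^ (1 - s) * Real.pi * Complex.Gamma s) *
    ((Complex.Gamma ((s + 1 + n) / 2))⁻¹ * (Complex.Gamma ((s + 1 - n) / 2))⁻¹)

lemma intervalIntegrable_exp_mul_sin_cpow {s : ℂ} (hs : 0 < s.re) (n : ℤ) :
    IntervalIntegrable (fun φ : ℝ => Complex.exp (n * φ * Complex.I) *
      ((Real.sin φ : ℝ) : ℂ) ^ (s - 1)) volume 0 Real.pi :=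
  (intervalIntegrable_sin_cpow hs).continuousOn_mul (by fun_prop)

lemma sinFourier_add_two {s : ℂ} (hs : 0 < s.re) (n : ℤ) :
    (s + 1 + n) * sinFourier s (n + 2) = (n + 1 - s) * sinFourier s n := by
  have hs0 : s ≠ 0 := by rintro rfl; simp at hs
  have hI1 := (intervalIntegrable_exp_mul_sin_cpow hs (n + 2)).const_mul ((s + 1 + n) / 2)
  have hI2 := (intervalIntegrable_exp_mul_sin_cpow hs n).const_mul ((n + 1 - s) / 2)
  have key := intervalIntegral.integral_eq_sub_of_hasDerivAt_of_le Real.pi_pos.le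
    (f := fun φ : ℝ => Complex.exp (((n : ℂ) + 1) * φ * Complex.I) * ((Real.sin φ : ℝ) : ℂ) ^ s)
    (Continuous.continuousOn (by
      have := (Complex.continuous_ofReal_cpow_const hs).comp Real.continuous_sin
      exact Continuous.mul (by fun_prop) this)) (fun φ hφ => ?_) (hI1.sub hI2)
  · rw [intervalIntegral.integral_sub hI1 hI2, intervalIntegral.integral_const_mul,
      intervalIntegral.integral_const_mul] at key
    simp only [Real.sin_pi, Real.sin_zero, Complex.ofReal_zero, Complex.zero_cpow hs0] at key
    change (s + 1 + n) / 2 * sinFourier s (n + 2) - (n + 1 - s) / 2 * sinFourier s n = _ at key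
    linear_combination 2 * key
  · have hsin : 0 < Real.sin φ := Real.sin_pos_of_mem_Ioo hφ
    have hne : ((Real.sin φ : ℝ) : ℂ) ≠ 0 := Complex.ofReal_ne_zero.mpr hsin.ne'
    have hd1 : HasDerivAt (fun φ : ℝ => Complex.exp (((n : ℂ) + 1) * φ * Complex.I))
        (Complex.exp (((n : ℂ) + 1) * φ * Complex.I) * (((n : ℂ) + 1) * Complex.I)) φ := by
      have := (((hasDerivAt_id (φ : ℂ)).const_mul ((n : ℂ) + 1)).mul_const
        Complex.I).cexp.comp_ofReal
      simpa using this
    have hd2 : HasDerivAt (fun φ : ℝ => ((Real.sin φ : ℝ) : ℂ) ^ s)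
        (s * ((Real.sin φ : ℝ) : ℂ) ^ (s - 1) * ((Real.cos φ : ℝ) : ℂ)) φ :=
      HasDerivAt.comp (h₂ := fun z : ℂ => z ^ s) φ (Complex.hasStrictDerivAt_cpow_const
        (Complex.ofReal_mem_slitPlane.mpr hsin)).hasDerivAt (Real.hasDerivAt_sin φ).ofReal_comp
    refine (hd1.mul hd2).congr_deriv ?_
    have hp : ((Real.sin φ : ℝ) : ℂ) ^ s = ((Real.sin φ : ℝ) : ℂ) ^ (s - 1) * Real.sin φ :=
      (cpow_sub_one_mul_self hne s).symm
    have e1 : Complex.exp (((n + 2 : ℤ) : ℂ) * φ * Complex.I) =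
        Complex.exp (((n : ℂ) + 1) * φ * Complex.I) * Complex.exp (φ * Complex.I) := by
      rw [← Complex.exp_add]; congr 1; push_cast; ring
    have e2 : Complex.exp ((n : ℂ) * φ * Complex.I) =
        Complex.exp (((n : ℂ) + 1) * φ * Complex.I) * Complex.exp (-φ * Complex.I) := by
      rw [← Complex.exp_add]; congr 1; ring
    rw [hp, e1, e2, Complex.exp_mul_I φ, Complex.exp_mul_I (-φ), Complex.cos_neg, Complex.sin_neg,
      Complex.ofReal_sin, Complex.ofReal_cos]
    ring

lemma sinFourierValue_add_two (s : ℂ) (n : ℤ) :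
    (s + 1 + n) * sinFourierValue s (n + 2) = (n + 1 - s) * sinFourierValue s n := by
  have hexp : Complex.exp (((n + 2 : ℤ) : ℂ) * Real.pi / 2 * Complex.I) =
      -Complex.exp (n * Real.pi / 2 * Complex.I) := by
    rw [← Complex.exp_add_pi_mul_I]; congr 1; push_cast; ring
  have h1 := Complex.one_div_Gamma_eq_self_mul_one_div_Gamma_add_one ((s + 1 + n) / 2)
  have h2 := Complex.one_div_Gamma_eq_self_mul_one_div_Gamma_add_one ((s + 1 - (n + 2 : ℤ)) / 2)
  rw [show (s + 1 + n) / 2 + 1 = (s + 1 + (n + 2 : ℤ)) / 2 by push_cast; ring] at h1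
  rw [show (s + 1 - (n + 2 : ℤ)) / 2 + 1 = (s + 1 - n) / 2 by push_cast; ring] at h2
  rw [sinFourierValue, sinFourierValue, hexp, h1, h2]
  push_cast
  ring

lemma sinFourier_zero {s : ℂ} (hs : 0 < s.re) : sinFourier s 0 = sinFourierValue s 0 := by
  have hG : Complex.Gamma s ≠ 0 := Complex.Gamma_ne_zero_of_re_pos hs
  have hG' : Complex.Gamma ((s + 1) / 2) ≠ 0 := Complex.Gamma_ne_zero_of_re_pos (by
    simp; linarith)
  have h2 : (2 : ℂ) ^ (s - 1) * (2 : ℂ) ^ (1 - s) = 1 := by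
    rw [← Complex.cpow_add _ _ two_ne_zero]; simp
  have h := integral_sin_cpow hs
  have hd := Gamma_half_sq_mul_Gamma_half_add_half_sq s
  simp only [sinFourier, sinFourierValue, Int.cast_zero, zero_mul, zero_div, Complex.exp_zero,
    one_mul, add_zero, sub_zero]
  rw [h]
  field_simp
  rw [mul_assoc, hd]
  linear_combination (Complex.Gamma s ^ 2 * (2 : ℂ) ^ (1 - s) * Real.pi) * h2

lemma sinFourier_one {s : ℂ} (hs : 0 < s.re) : sinFourier s 1 = sinFourierValue s 1 := by
  have hs0 : s ≠ 0 := by rintro rfl; simp at hs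
  have hG : Complex.Gamma (s + 1) ≠ 0 := Complex.Gamma_ne_zero_of_re_pos (by simp; linarith)
  have hG0 : Complex.Gamma s ≠ 0 := Complex.Gamma_ne_zero_of_re_pos hs
  have hG' : Complex.Gamma (s / 2) ≠ 0 := Complex.Gamma_ne_zero_of_re_pos (by simpa using hs)
  have hrec := sinFourier_add_two hs (-1)
  norm_num at hrec
  have hneg : sinFourier s 1 = -sinFourier s (-1) := by
    apply mul_left_cancel₀ hs0; rw [hrec]; ring
  have hsub : sinFourier s 1 - sinFourier s (-1) =
      2 * Complex.I * ∫ φ in (0 : ℝ)..Real.pi, ((Real.sin φ : ℝ) : ℂ) ^ (s + 1 - 1) := by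
    rw [sinFourier, sinFourier, ← intervalIntegral.integral_sub
      (intervalIntegrable_exp_mul_sin_cpow hs 1) (intervalIntegrable_exp_mul_sin_cpow hs (-1)),
      ← intervalIntegral.integral_const_mul]
    rw [intervalIntegral.integral_of_le Real.pi_pos.le,
      intervalIntegral.integral_of_le Real.pi_pos.le, integral_Ioc_eq_integral_Ioo,
      integral_Ioc_eq_integral_Ioo]
    refine setIntegral_congr_fun measurableSet_Ioo fun φ hφ => ?_
    have hne : ((Real.sin φ : ℝ) : ℂ) ≠ 0 :=
      Complex.ofReal_ne_zero.mpr (Real.sin_pos_of_mem_Ioo hφ).ne'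
    have hp : ((Real.sin φ : ℝ) : ℂ) ^ (s + 1 - 1) =
        ((Real.sin φ : ℝ) : ℂ) ^ (s - 1) * Real.sin φ := by
      rw [cpow_sub_one_mul_self hne, add_sub_cancel_right]
    simp only [hp]
    push_cast
    rw [one_mul, neg_one_mul, Complex.exp_mul_I, Complex.exp_mul_I, Complex.cos_neg,
      Complex.sin_neg]
    ring
  have hint := integral_sin_cpow (a := s + 1) (by simp; linarith)
  have hI : sinFourier s 1 = Complex.I * ((2 : ℂ) ^ s * Complex.Gamma ((s + 1) / 2) ^ 2 /
      Complex.Gamma (s + 1)) := by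
    rw [hint, add_sub_cancel_right] at hsub
    linear_combination hsub / 2 + hneg / 2
  have hd := Gamma_half_sq_mul_Gamma_half_add_half_sq s
  have h2 : (2 : ℂ) ^ s * (2 : ℂ) ^ (1 - s) = 2 := by
    rw [← Complex.cpow_add _ _ two_ne_zero]; simp
  rw [hI, sinFourierValue, Complex.Gamma_add_one s hs0]
  simp only [Int.cast_one, one_mul, Complex.exp_pi_div_two_mul_I, add_sub_cancel_right]
  rw [show (s + 1 + 1) / 2 = s / 2 + 1 by ring,
    Complex.Gamma_add_one _ (div_ne_zero hs0 two_ne_zero)]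
  field_simp
  linear_combination (2 : ℂ) ^ s * hd +
    (Complex.Gamma s ^ 2 * (2 : ℂ) ^ (1 - s) * Real.pi) * h2

/-- The integral of `exp (i n φ) * sin φ ^ (s - 1)` over `[0, π]`, for `0 < re s < 1`. -/
lemma sinFourier_eq {s : ℂ} (hs : 0 < s.re) (hs1 : s.re < 1) (n : ℤ) :
    sinFourier s n = sinFourierValue s n := by
  have hA (m : ℤ) : s + 1 + m ≠ 0 := fun h => by
    have h := congrArg Complex.re h
    simp only [Complex.add_re, Complex.one_re, Complex.intCast_re, Complex.zero_re] at h
    have h1 : ((-1 - m : ℤ) : ℝ) = s.re := by push_cast; linarith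
    rw [← h1] at hs hs1
    norm_cast at hs hs1
    omega
  have hB (m : ℤ) : (m : ℂ) + 1 - s ≠ 0 := fun h => by
    have h := congrArg Complex.re h
    simp only [Complex.add_re, Complex.sub_re, Complex.one_re, Complex.intCast_re,
      Complex.zero_re] at h
    have h1 : ((m + 1 : ℤ) : ℝ) = s.re := by push_cast; linarith
    rw [← h1] at hs hs1
    norm_cast at hs hs1
    omega
  have hstep (m : ℤ) :
      sinFourier s m = sinFourierValue s m ↔ sinFourier s (m + 2) = sinFourierValue s (m + 2) := by
    rw [← mul_right_inj' (hB m), ← sinFourier_add_two hs, ← sinFourierValue_add_two,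
      mul_right_inj' (hA m)]
  have hall (k : ℤ) : sinFourier s (2 * k) = sinFourierValue s (2 * k) ∧
      sinFourier s (2 * k + 1) = sinFourierValue s (2 * k + 1) := by
    induction k using Int.induction_on with
    | zero => exact ⟨sinFourier_zero hs, sinFourier_one hs⟩
    | succ i ih =>
      rw [hstep, hstep (2 * i + 1)] at ih
      convert ih using 2 <;> ring_nf
    | pred i ih =>
      rw [hstep, hstep (2 * (-i - 1) + 1)]
      convert ih using 2 <;> ring_nf
  obtain h | h := Int.even_or_odd' n |>.choose_spec
  · rw [h]; exact (hall _).1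
  · rw [h]; exact (hall _).2

/-- for `ε ∈ {0,1}`, `μ ≡ ε (mod 2)`, `-1/2 < Re ζ < 0`, and every `θ ∈ ℝ`,
`(1/2)∫_{-π}^{π} e^{iμφ} sgn(sin(φ-θ))^ε |sin(φ-θ)|^{-1-2ζ} dφ = b(ζ,μ) e^{iμθ}`, where
`b(ζ,μ) = σ(μ,ε) 2^{1+2ζ} π Γ(-2ζ)/(Γ(1/2-ζ+μ/2) Γ(1/2-ζ-μ/2))` and
`σ(μ,ε) = (1-ε)cos(μπ/2) + iε sin(μπ/2)`: the circle exponentials are eigenfunctions of the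
intertwining operator. -/
theorem stmt_8 (ε : ℕ) (hε : ε = 0 ∨ ε = 1) (μ : ℤ) (hμ : μ % 2 = (ε : ℤ))
    (ζ : ℂ) (h1 : -(1/2) < ζ.re) (h2 : ζ.re < 0) :
    ∀ θ : ℝ,
      ((1/2 : ℂ) * ∫ φ in (-Real.pi)..Real.pi,
          Complex.exp ((μ : ℂ) * (φ : ℂ) * Complex.I) *
            ((Real.sign (Real.sin (φ - θ)) : ℝ) : ℂ) ^ ε *
            ((|Real.sin (φ - θ)| : ℝ) : ℂ) ^ (-1 - 2 * ζ))
        = (((1 : ℂ) - (ε : ℂ)) * ((Real.cos ((μ : ℝ) * Real.pi / 2) : ℝ) : ℂ)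
              + Complex.I * (ε : ℂ) * ((Real.sin ((μ : ℝ) * Real.pi / 2) : ℝ) : ℂ)) *
            (2 : ℂ) ^ (1 + 2 * ζ) * (Real.pi : ℂ) * Complex.Gamma (-2 * ζ) /
            (Complex.Gamma (1/2 - ζ + (μ : ℂ)/2) * Complex.Gamma (1/2 - ζ - (μ : ℂ)/2)) *
            Complex.exp ((μ : ℂ) * (θ : ℂ) * Complex.I) := by
  intro θ
  set s : ℂ := -2 * ζ with hs
  have hs0 : 0 < s.re := by simp [hs]; linarith
  have hs1 : s.re < 1 := by simp [hs]; linarith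
  have hexp : Complex.exp (μ * Real.pi * Complex.I) = (-1) ^ ε := by
    rw [mul_assoc, Complex.exp_int_mul, Complex.exp_pi_mul_I]
    rcases hε with rfl | rfl
    · rw [Even.neg_one_zpow (Int.even_iff.mpr hμ), pow_zero]
    · rw [Odd.neg_one_zpow (Int.odd_iff.mpr hμ), pow_one]
  set K : ℝ → ℂ := fun x => Complex.exp (μ * x * Complex.I) *
    ((Real.sign (Real.sin x) : ℝ) : ℂ) ^ ε * ((|Real.sin x| : ℝ) : ℂ) ^ (s - 1) with hK
  have hper : Function.Periodic K Real.pi := fun x => by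
    have he : Complex.exp (μ * ((x + Real.pi : ℝ) : ℂ) * Complex.I) =
        Complex.exp (μ * x * Complex.I) * (-1) ^ ε := by
      rw [← hexp, ← Complex.exp_add]; congr 1; push_cast; ring
    simp only [hK, Real.sin_add_pi, abs_neg, Real.sign_neg, Complex.ofReal_neg, he]
    rw [neg_pow (((Real.sin x).sign : ℝ) : ℂ)]
    linear_combination (Complex.exp (μ * x * Complex.I) * (((Real.sin x).sign : ℝ) : ℂ) ^ ε *
      ((|Real.sin x| : ℝ) : ℂ) ^ (s - 1)) * (by rw [← mul_pow]; simp : (-1 : ℂ) ^ ε * (-1) ^ ε = 1)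
  have hKeq : Set.EqOn (fun φ : ℝ => Complex.exp (μ * φ * Complex.I) *
      ((Real.sin φ : ℝ) : ℂ) ^ (s - 1)) K (Set.Ioo 0 Real.pi) := fun φ hφ => by
    have := Real.sin_pos_of_mem_Ioo hφ
    simp only [hK, Real.sign_of_pos this, abs_of_pos this, Complex.ofReal_one, one_pow, mul_one]
  have hKint : IntervalIntegrable K volume 0 Real.pi := by
    have := intervalIntegrable_exp_mul_sin_cpow hs0 μ
    rw [intervalIntegrable_iff_integrableOn_Ioo_of_le Real.pi_pos.le] at this ⊢
    exact this.congr_fun hKeq measurableSet_Ioo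
  have hK0 : ∫ φ in (0 : ℝ)..Real.pi, K φ = sinFourierValue s μ := by
    rw [← sinFourier_eq hs0 hs1, sinFourier, intervalIntegral.integral_of_le Real.pi_pos.le,
      intervalIntegral.integral_of_le Real.pi_pos.le, integral_Ioc_eq_integral_Ioo,
      integral_Ioc_eq_integral_Ioo]
    exact (setIntegral_congr_fun measurableSet_Ioo hKeq).symm
  have hfull : ∫ φ in (-Real.pi)..Real.pi, K (φ - θ) = 2 * sinFourierValue s μ := by
    have h := hper.intervalIntegral_add_zsmul_eq 2 (-Real.pi - θ)
      (hper.intervalIntegrable₀ Real.pi_ne_zero hKint)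
    rw [hper.intervalIntegral_add_eq _ 0, zero_add, hK0] at h
    rw [intervalIntegral.integral_comp_sub_right]
    convert h using 2
    · simp; ring
    · simp
  have hint : ∀ φ : ℝ, Complex.exp ((μ : ℂ) * (φ : ℂ) * Complex.I) *
      ((Real.sign (Real.sin (φ - θ)) : ℝ) : ℂ) ^ ε *
      ((|Real.sin (φ - θ)| : ℝ) : ℂ) ^ (-1 - 2 * ζ) =
      Complex.exp (μ * θ * Complex.I) * K (φ - θ) := fun φ => by
    have he : Complex.exp ((μ : ℂ) * (φ : ℂ) * Complex.I) = Complex.exp (μ * θ * Complex.I) *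
        Complex.exp (μ * ((φ - θ : ℝ) : ℂ) * Complex.I) := by
      rw [← Complex.exp_add]; congr 1; push_cast; ring
    rw [he, show -1 - 2 * ζ = s - 1 by rw [hs]; ring]
    simp only [hK]
    ring
  have hσ : ((1 : ℂ) - (ε : ℂ)) * ((Real.cos ((μ : ℝ) * Real.pi / 2) : ℝ) : ℂ)
      + Complex.I * (ε : ℂ) * ((Real.sin ((μ : ℝ) * Real.pi / 2) : ℝ) : ℂ) =
      Complex.exp (μ * Real.pi / 2 * Complex.I) := by
    have he : Complex.exp (μ * Real.pi / 2 * Complex.I) =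
        ((Real.cos ((μ : ℝ) * Real.pi / 2) : ℝ) : ℂ) +
          ((Real.sin ((μ : ℝ) * Real.pi / 2) : ℝ) : ℂ) * Complex.I := by
      rw [Complex.exp_mul_I]; push_cast; rfl
    rw [he]
    rcases hε with rfl | rfl
    · obtain ⟨k, rfl⟩ := Int.even_iff.mpr hμ
      have : Real.sin (((k + k : ℤ) : ℝ) * Real.pi / 2) = 0 := by
        rw [← Real.sin_int_mul_pi k]; congr 1; push_cast; ring
      rw [this]; simp
    · obtain ⟨k, rfl⟩ := Int.odd_iff.mpr hμ
      have : Real.cos (((2 * k + 1 : ℤ) : ℝ) * Real.pi / 2) = 0 :=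
        Real.cos_eq_zero_iff.mpr ⟨k, by push_cast; ring⟩
      rw [this]; simp [mul_comm]
  simp_rw [hint]
  rw [intervalIntegral.integral_const_mul, hfull, hσ, sinFourierValue,
    show (1 : ℂ) / 2 - ζ + μ / 2 = (s + 1 + μ) / 2 by rw [hs]; ring,
    show (1 : ℂ) / 2 - ζ - μ / 2 = (s + 1 - μ) / 2 by rw [hs]; ring,
    show 1 + 2 * ζ = 1 - s by rw [hs]; ring]
  ring
end
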